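/- arXiv:2108.09472 — 5 statements merged into one kernel-verified Lean document; each statement's English description precedes it below -/
import Mathlib

section
/- Let (Ω, 𝒜, P) be a probability space and let 𝔉 and 𝔊 be two sub-σ-algebras of 𝒜. Let ε > 0 and suppose there is an event B ∈ 𝔉 such that for every A ∈ 𝔉 with A ⊆ B and P(A) > 0 and every A' ∈ 𝔊 one has |P(A' ∩ A)/P(A) − P(A')| ≤ ε. Then for every finite partition A₁, …, A_I of Ω into sets belonging to 𝔉 and every finite partition A'₁, …, A'_J of Ω into sets belonging to 𝔊, one has (1/2) Σ_{i=1}^{I} Σ_{j=1}^{J} |P(A_i ∩ A'_j) − P(A_i) P(A'_j)| ≤ ε · P(B) + P(Ω \ B). -/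
open MeasureTheory

theorem aux_sum_real {Ω : Type*} {m : MeasurableSpace Ω} (P : Measure Ω)
    [IsProbabilityMeasure P] {J : ℕ} (A' : Fin J → Set Ω)
    (hA' : ∀ j, MeasurableSet (A' j))
    (hd : Pairwise (Function.onFun Disjoint A')) (S : Set Ω) (hS : MeasurableSet S)
    (t : Finset (Fin J)) :
    ∑ j ∈ t, P.real (S ∩ A' j) = P.real (S ∩ ⋃ j ∈ t, A' j) := by
  have : (S ∩ ⋃ j ∈ t, A' j) = ⋃ j ∈ t, (S ∩ A' j) := by
    simp only [Set.inter_iUnion]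
  rw [this, measureReal_biUnion_finset]
  · intro i _ j _ hij
    exact (hd hij).mono Set.inter_subset_right Set.inter_subset_right
  · intro j _
    exact hS.inter (hA' j)

theorem aux_abs_sum {Ω : Type*} {m : MeasurableSpace Ω} (P : Measure Ω)
    [IsProbabilityMeasure P] (G : MeasurableSpace Ω) (hG : G ≤ m) {J : ℕ} (A' : Fin J → Set Ω)
    (hA' : ∀ j, MeasurableSet[G] (A' j))
    (hd : Pairwise (Function.onFun Disjoint A')) (S : Set Ω) (hS : MeasurableSet[m] S)
    (c : ℝ) (h : ∀ T : Set Ω, MeasurableSet[G] T →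
      |P.real (S ∩ T) - P.real S * P.real T| ≤ c) :
    ∑ j, |P.real (S ∩ A' j) - P.real S * P.real (A' j)| ≤ 2 * c := by
  have key : ∀ t : Finset (Fin J),
      |∑ j ∈ t, (P.real (S ∩ A' j) - P.real S * P.real (A' j))| ≤ c := by
    intro t
    have h1 := aux_sum_real P A' (fun j => hG _ (hA' j)) hd S hS t
    have h2 := aux_sum_real P A' (fun j => hG _ (hA' j)) hd Set.univ MeasurableSet.univ t
    simp only [Set.univ_inter] at h2
    rw [Finset.sum_sub_distrib, ← Finset.mul_sum, h1, h2]
    exact h _ (Finset.measurableSet_biUnion t fun j _ => hA' j)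
  rw [← Finset.sum_filter_add_sum_filter_not Finset.univ
    (fun j => 0 ≤ P.real (S ∩ A' j) - P.real S * P.real (A' j))]
  have k1 := key (Finset.univ.filter
    (fun j => 0 ≤ P.real (S ∩ A' j) - P.real S * P.real (A' j)))
  have k2 := key (Finset.univ.filter
    (fun j => ¬ 0 ≤ P.real (S ∩ A' j) - P.real S * P.real (A' j)))
  rw [Finset.sum_congr rfl (fun j hj => abs_of_nonneg (Finset.mem_filter.1 hj).2),
    Finset.sum_congr (s₁ := Finset.univ.filter
      (fun j => ¬ 0 ≤ P.real (S ∩ A' j) - P.real S * P.real (A' j))) rfl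
      (fun j hj => abs_of_neg (not_le.1 (Finset.mem_filter.1 hj).2)),
    Finset.sum_neg_distrib]
  have := (abs_le.1 k1).2
  have := (abs_le.1 k2).1
  linarith

/-- Lemma 3.2 (from Morwald–Neumann style): if there is an event `B ∈ 𝔉` such that
conditionally on any positive-probability `𝔉`-event inside `B` the probability of any
`𝔊`-event changes by at most `ε`, then every partition sum appearing in the definition of
the absolute regularity coefficient is bounded by `ε ⬝ P(B) + P(Bᶜ)`. -/
theorem absolute_regularity_partition_bound
    {Ω : Type*} {𝒜 : MeasurableSpace Ω} (P : Measure Ω) [IsProbabilityMeasure P]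
    (𝔉 𝔊 : MeasurableSpace Ω) (h𝔉 : 𝔉 ≤ 𝒜) (h𝔊 : 𝔊 ≤ 𝒜)
    (ε : ℝ) (hε : 0 < ε) (B : Set Ω) (hB : MeasurableSet[𝔉] B)
    (hyp : ∀ A : Set Ω, MeasurableSet[𝔉] A → A ⊆ B → 0 < (P A).toReal →
      ∀ A' : Set Ω, MeasurableSet[𝔊] A' →
        |(P (A' ∩ A)).toReal / (P A).toReal - (P A').toReal| ≤ ε)
    (I J : ℕ) (A : Fin I → Set Ω) (A' : Fin J → Set Ω)
    (hA : ∀ i, MeasurableSet[𝔉] (A i)) (hA' : ∀ j, MeasurableSet[𝔊] (A' j))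
    (hdisj : Pairwise (Function.onFun Disjoint A))
    (hdisj' : Pairwise (Function.onFun Disjoint A'))
    (hcover : (⋃ i, A i) = Set.univ) (hcover' : (⋃ j, A' j) = Set.univ) :
    (1/2) * ∑ i, ∑ j,
        |(P (A i ∩ A' j)).toReal - (P (A i)).toReal * (P (A' j)).toReal|
      ≤ ε * (P B).toReal + (P Bᶜ).toReal := by
  have hBm := h𝔉 _ hB
  have hAm := fun i => h𝔉 _ (hA i)
  simp only [← measureReal_def] at hyp ⊢
  have hrow : ∀ i, ∑ j, |P.real (A i ∩ A' j) - P.real (A i) * P.real (A' j)|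
      ≤ 2 * (ε * P.real (B ∩ A i)) + 2 * P.real (Bᶜ ∩ A i) := by
    intro i
    have e1 := aux_abs_sum P 𝔊 h𝔊 A' hA' hdisj' (B ∩ A i) (hBm.inter (hAm i))
      (ε * P.real (B ∩ A i)) (by
        intro T hT
        rcases (measureReal_nonneg (μ := P) (s := B ∩ A i)).eq_or_lt with h0 | h0
        · have : P.real (B ∩ A i ∩ T) = 0 := le_antisymm
            (h0 ▸ measureReal_mono Set.inter_subset_left) measureReal_nonneg
          rw [this, ← h0]; simp
        · have h1 := hyp (B ∩ A i) (MeasurableSet.inter hB (hA i)) Set.inter_subset_left h0 T hT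
          rw [Set.inter_comm (B ∩ A i) T]
          have h2 : P.real (T ∩ (B ∩ A i)) - P.real (B ∩ A i) * P.real T
              = (P.real (T ∩ (B ∩ A i)) / P.real (B ∩ A i) - P.real T) * P.real (B ∩ A i) := by
            field_simp
          rw [h2, abs_mul, abs_of_pos h0]
          exact mul_le_mul_of_nonneg_right h1 h0.le)
    have e2 := aux_abs_sum P 𝔊 h𝔊 A' hA' hdisj' (Bᶜ ∩ A i) (hBm.compl.inter (hAm i))
      (P.real (Bᶜ ∩ A i)) (by
        intro T hT
        have h1 : P.real (Bᶜ ∩ A i ∩ T) ≤ P.real (Bᶜ ∩ A i) :=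
          measureReal_mono Set.inter_subset_left
        have h2 : P.real (Bᶜ ∩ A i) * P.real T ≤ P.real (Bᶜ ∩ A i) :=
          mul_le_of_le_one_right measureReal_nonneg measureReal_le_one
        have h3 : 0 ≤ P.real (Bᶜ ∩ A i ∩ T) := measureReal_nonneg
        have h4 : 0 ≤ P.real (Bᶜ ∩ A i) * P.real T :=
          mul_nonneg measureReal_nonneg measureReal_nonneg
        rw [abs_le]; constructor <;> linarith)
    refine le_trans ?_ (add_le_add e1 e2)
    rw [← Finset.sum_add_distrib]
    refine Finset.sum_le_sum fun j _ => ?_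
    have split : ∀ S : Set Ω, P.real S = P.real (B ∩ S) + P.real (Bᶜ ∩ S) := by
      intro S
      rw [← measureReal_inter_add_sdiff (s := S) hBm, Set.inter_comm S B, Set.diff_eq,
        Set.inter_comm S Bᶜ]
    rw [split (A i ∩ A' j), split (A i), ← Set.inter_assoc, ← Set.inter_assoc]
    refine le_trans (le_of_eq ?_) (abs_add_le _ _)
    congr 1; ring
  have s1 := aux_sum_real P A hAm hdisj B hBm Finset.univ
  have s2 := aux_sum_real P A hAm hdisj Bᶜ hBm.compl Finset.univ
  simp only [Finset.mem_univ, Set.iUnion_true, hcover, Set.inter_univ] at s1 s2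
  have := Finset.sum_le_sum fun i (_ : i ∈ Finset.univ) => hrow i
  rw [Finset.sum_add_distrib, ← Finset.mul_sum, ← Finset.mul_sum, ← Finset.mul_sum, s1, s2] at this
  linarith
end

section
/- Let (Ω, 𝒜, P) be a probability space, let (𝔉_n)_{n∈ℕ} be an increasing family of sub-σ-algebras of 𝒜 whose union generates 𝒜, and let (𝔊_m)_{m∈ℕ} be a family of sub-σ-algebras of 𝒜. Assume that for every n ∈ ℕ and every ε > 0 there exists m ∈ ℕ such that |P(A ∩ A') − P(A)P(A')| ≤ ε for all A ∈ 𝔉_n and all A' ∈ 𝔊_m. Then every event A' belonging to the tail σ-algebra ⋂_{m∈ℕ} 𝔊_m satisfies P(A') ∈ {0, 1}. -/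
open MeasureTheory

/-- α-mixing implies tail triviality: if the strong mixing coefficients between an
increasing generating family `(𝔉 n)` and a family `(𝔊 m)` of sub-σ-algebras can be made
arbitrarily small, then the tail σ-algebra `⋂ m, 𝔊 m` is trivial. -/
theorem alpha_mixing_implies_tail_trivial
    {Ω : Type*} {𝒜 : MeasurableSpace Ω} (P : Measure Ω) [IsProbabilityMeasure P]
    (𝔉 : ℕ → MeasurableSpace Ω) (hmono : Monotone 𝔉) (h𝔉 : ∀ n, 𝔉 n ≤ 𝒜)
    (hgen : (⨆ n, 𝔉 n) = 𝒜)
    (𝔊 : ℕ → MeasurableSpace Ω) (h𝔊 : ∀ m, 𝔊 m ≤ 𝒜)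
    (hmix : ∀ n : ℕ, ∀ ε : ℝ, 0 < ε → ∃ m : ℕ,
      ∀ A : Set Ω, MeasurableSet[𝔉 n] A → ∀ A' : Set Ω, MeasurableSet[𝔊 m] A' →
        |(P (A ∩ A')).toReal - (P A).toReal * (P A').toReal| ≤ ε)
    (A' : Set Ω) (hA' : MeasurableSet[⨅ m, 𝔊 m] A') :
    P A' = 0 ∨ P A' = 1 := by
  have hle : (⨅ m, 𝔊 m) ≤ 𝒜 := (iInf_le 𝔊 0).trans (h𝔊 0)
  have hind : ∀ n, ProbabilityTheory.Indep (𝔉 n) (⨅ m, 𝔊 m) P := by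
    intro n
    rw [ProbabilityTheory.Indep_iff]
    intro A B hA hB
    have h0 : |(P (A ∩ B)).toReal - (P A).toReal * (P B).toReal| ≤ 0 := by
      refine le_of_forall_pos_le_add fun ε hε => ?_
      obtain ⟨m, hm⟩ := hmix n ε hε
      have := hm A hA B (iInf_le 𝔊 m B hB)
      linarith
    have h1 := sub_eq_zero.mp (abs_eq_zero.mp (le_antisymm h0 (abs_nonneg _)))
    rw [← ENNReal.toReal_mul] at h1
    exact (ENNReal.toReal_eq_toReal_iff' (measure_ne_top _ _)
      (ENNReal.mul_ne_top (measure_ne_top _ _) (measure_ne_top _ _))).mp h1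
  have hsup := ProbabilityTheory.indep_iSup_of_monotone hind h𝔉 hle hmono
  have hself : ProbabilityTheory.Indep (⨅ m, 𝔊 m) (⨅ m, 𝔊 m) P :=
    ProbabilityTheory.indep_of_indep_of_le_left hsup (hle.trans hgen.ge)
  exact ProbabilityTheory.measure_eq_zero_or_one_of_indep_self hself hA'
end

section
/- For every integer d ≥ 2 and all reals β > −1, A ≥ 0 and t > 0, one has ∫_0^t (A + √(t − h))^{d−1} h^β dh < √π · Γ(β+1) · t^{β+1} · (A + √t)^{d−1}. -/
open MeasureTheory Real

lemma aux_gamma (x : ℝ) (hx : 1 < x) : 1 < Real.sqrt Real.pi * Real.Gamma x := by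
  have hs2 : Real.sqrt Real.pi * Real.sqrt Real.pi = Real.pi :=
    Real.mul_self_sqrt Real.pi_pos.le
  have hpi := Real.pi_gt_three
  have hpi4 := Real.pi_le_four
  have hs0 : 0 ≤ Real.sqrt Real.pi := Real.sqrt_nonneg _
  have hs1 : 1 < Real.sqrt Real.pi := by nlinarith
  have hsle : Real.sqrt Real.pi ≤ 2 := by nlinarith
  rcases le_total 2 x with h | h
  · have : Real.Gamma 2 ≤ Real.Gamma x :=
      Real.Gamma_strictMonoOn_Ici.monotoneOn (Set.mem_Ici.2 le_rfl) (Set.mem_Ici.2 h) h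
    rw [Real.Gamma_two] at this
    nlinarith
  · obtain ⟨-, hc⟩ := Real.convexOn_Gamma
    have h1 := hc (Set.mem_Ioi.2 (by linarith : 0 < x))
      (Set.mem_Ioi.2 (by linarith : 0 < 3 - x)) (by norm_num : (0:ℝ) ≤ 1/2)
      (by norm_num : (0:ℝ) ≤ 1/2) (by norm_num)
    have h2 := hc (Set.mem_Ioi.2 (by norm_num : (0:ℝ) < 1))
      (Set.mem_Ioi.2 (by norm_num : (0:ℝ) < 2)) (by linarith : 0 ≤ x - 1)
      (by linarith : 0 ≤ 2 - x) (by ring)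
    simp only [smul_eq_mul, Real.Gamma_one, Real.Gamma_two] at h1 h2
    have e1 : 1/2 * x + 1/2 * (3 - x) = 1/2 + 1 := by ring
    have e2 : (x - 1) * 1 + (2 - x) * 2 = 3 - x := by ring
    rw [e1, Real.Gamma_add_one (by norm_num), Real.Gamma_one_half_eq] at h1
    rw [e2] at h2
    have h3 : Real.sqrt Real.pi - 1 ≤ Real.Gamma x := by linarith
    have hpi' := Real.pi_gt_d2
    nlinarith

/-- The upper bound `∫_0^t (A + √(t-h))^{d-1} h^β dh < √π Γ(β+1) t^{β+1} (A+√t)^{d-1}`,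
the analytic content of the lower-boundary concentration bound in Lemma 4.1(2a). -/
theorem intensity_integral_beta_lt
    (d : ℕ) (hd : 2 ≤ d) (β A t : ℝ) (hβ : -1 < β) (hA : 0 ≤ A) (ht : 0 < t) :
    ∫ h in Set.Ioo (0:ℝ) t, (A + Real.sqrt (t - h)) ^ (d - 1) * h ^ β <
      Real.sqrt Real.pi * Real.Gamma (β + 1) * t ^ (β + 1) *
        (A + Real.sqrt t) ^ (d - 1) := by
  have hb : 0 < β + 1 := by linarith
  have hG := aux_gamma (β + 1 + 1) (by linarith)
  rw [Real.Gamma_add_one hb.ne'] at hG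
  have hC : 0 < (A + Real.sqrt t) ^ (d - 1) :=
    pow_pos (add_pos_of_nonneg_of_pos hA (Real.sqrt_pos.2 ht)) _
  have hT : 0 < t ^ (β + 1) := Real.rpow_pos_of_pos ht _
  have hint : IntegrableOn (fun h : ℝ => h ^ β) (Set.Ioo 0 t) :=
    (intervalIntegral.integrableOn_Ioo_rpow_iff ht).2 hβ
  have hval : ∫ h in Set.Ioo (0:ℝ) t, h ^ β = t ^ (β + 1) / (β + 1) := by
    rw [← integral_Ioc_eq_integral_Ioo, ← intervalIntegral.integral_of_le ht.le,
      integral_rpow (Or.inl hβ), Real.zero_rpow hb.ne', sub_zero]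
  have hle : ∫ h in Set.Ioo (0:ℝ) t, (A + Real.sqrt (t - h)) ^ (d - 1) * h ^ β ≤
      ∫ h in Set.Ioo (0:ℝ) t, (A + Real.sqrt t) ^ (d - 1) * h ^ β := by
    apply integral_mono_of_nonneg
    · filter_upwards [ae_restrict_mem measurableSet_Ioo] with h hh
      have := Real.rpow_nonneg hh.1.le β
      simp only [Pi.zero_apply]
      positivity
    · exact hint.const_mul _
    · filter_upwards [ae_restrict_mem measurableSet_Ioo] with h hh
      have := Real.rpow_nonneg hh.1.le β
      have h0 := hh.1
      have : Real.sqrt (t - h) ≤ Real.sqrt t := Real.sqrt_le_sqrt (by linarith)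
      gcongr
  refine hle.trans_lt ?_
  rw [integral_const_mul, hval, mul_comm]
  refine mul_lt_mul_of_pos_right ?_ hC
  rw [div_lt_iff₀ hb]
  nlinarith
end

section
/- For every integer d ≥ 2 and all reals β > (d+1)/2, A ≥ 0 and u > 0, one has ∫_u^∞ (A + √(h − u))^{d−1} h^{−β} dh ≤ (√π · Γ((d+1)/2) · max(Γ(β − (d+1)/2), Γ(β − 1)) / Γ(β)) · u^{1−β} · (A + √u)^{d−1}. -/
open MeasureTheory Real

lemma beta_aux {a b : ℝ} (ha : 0 < a) (hb : 0 < b) :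
    IntegrableOn (fun x : ℝ => x ^ (a - 1) * (1 - x) ^ (b - 1)) (Set.Ioo 0 1) ∧
    ∫ x in Set.Ioo (0:ℝ) 1, x ^ (a - 1) * (1 - x) ^ (b - 1) =
      Real.Gamma a * Real.Gamma b / Real.Gamma (a + b) := by
  have hB := ProbabilityTheory.beta_pos ha hb
  have h1 := ProbabilityTheory.lintegral_betaPDF_eq_one ha hb
  rw [ProbabilityTheory.lintegral_betaPDF] at h1
  set B := ProbabilityTheory.beta a b with hBdef
  set g : ℝ → ℝ := fun x => 1 / B * x ^ (a - 1) * (1 - x) ^ (b - 1) with hg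
  have hmeas : AEStronglyMeasurable g (volume.restrict (Set.Ioo 0 1)) := by
    apply Measurable.aestronglyMeasurable
    fun_prop
  have hnn : 0 ≤ᵐ[volume.restrict (Set.Ioo 0 1)] g := by
    filter_upwards [ae_restrict_mem measurableSet_Ioo] with x hx
    have h0 : 0 < x := hx.1
    have h2 : 0 < 1 - x := by linarith [hx.2]
    simp only [hg, Pi.zero_apply]
    positivity
  have hint : Integrable g (volume.restrict (Set.Ioo 0 1)) := by
    refine ⟨hmeas, ?_⟩
    rw [hasFiniteIntegral_iff_ofReal hnn, h1]
    exact ENNReal.one_lt_top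
  have hval : ∫ x in Set.Ioo (0:ℝ) 1, g x = 1 := by
    rw [integral_eq_lintegral_of_nonneg_ae hnn hmeas, h1]; simp
  have hfg : (fun x : ℝ => x ^ (a - 1) * (1 - x) ^ (b - 1)) = fun x => B * g x := by
    funext x
    simp only [hg]
    field_simp
  constructor
  · rw [hfg]; exact hint.const_mul B
  · rw [hfg, integral_const_mul, hval, mul_one]; rfl

lemma pow_int_aux {c β u : ℝ} (hc : 0 < c) (hcβ : c < β) (hu : 0 < u) :
    IntegrableOn (fun h : ℝ => (h - u) ^ (c - 1) * h ^ (-β)) (Set.Ioi u) ∧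
    ∫ h in Set.Ioi u, (h - u) ^ (c - 1) * h ^ (-β) =
      u ^ (c - β) * (Real.Gamma c * Real.Gamma (β - c) / Real.Gamma β) := by
  obtain ⟨hi, hv⟩ := beta_aux (sub_pos.2 hcβ) hc
  have himg : (fun x : ℝ => u / x) '' Set.Ioo 0 1 = Set.Ioi u := by
    ext h
    simp only [Set.mem_image, Set.mem_Ioo, Set.mem_Ioi]
    constructor
    · rintro ⟨x, ⟨h0, h1⟩, rfl⟩
      rw [lt_div_iff₀ h0]; nlinarith
    · intro hh
      have : 0 < h := hu.trans hh
      refine ⟨u / h, ⟨by positivity, by rwa [div_lt_one this]⟩, ?_⟩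
      field_simp
  have hder : ∀ x ∈ Set.Ioo (0:ℝ) 1,
      HasDerivWithinAt (fun x : ℝ => u / x) (-u / x ^ 2) (Set.Ioo 0 1) x := by
    intro x hx
    have := ((hasDerivAt_inv hx.1.ne').const_mul u).hasDerivWithinAt (s := Set.Ioo 0 1)
    have e : -u / x ^ 2 = u * -(x ^ 2)⁻¹ := by ring
    rw [e]
    simpa only [div_eq_mul_inv] using this
  have hinj : Set.InjOn (fun x : ℝ => u / x) (Set.Ioo 0 1) := by
    intro x hx y hy hxy
    have := hx.1.ne'
    have := hy.1.ne'
    simp only at hxy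
    field_simp at hxy
    exact hxy.symm
  have hEq : Set.EqOn (fun x : ℝ => |-u / x ^ 2| • ((u / x - u) ^ (c - 1) * (u / x) ^ (-β)))
      (fun x => u ^ (c - β) * (x ^ (β - c - 1) * (1 - x) ^ (c - 1))) (Set.Ioo 0 1) := by
    intro x hx
    have h0 : 0 < x := hx.1
    have h1 : 0 < 1 - x := by linarith [hx.2]
    have e1 : u / x - u = u * ((1 - x) * x⁻¹) := by field_simp
    have e2 : |-u / x ^ 2| = u * x ^ (-2 : ℝ) := by
      rw [neg_div, abs_neg, abs_of_pos (by positivity), rpow_neg h0.le, rpow_two]; rfl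
    simp only [smul_eq_mul]
    rw [e1, e2, mul_rpow hu.le (by positivity), mul_rpow h1.le (by positivity),
      div_eq_mul_inv, mul_rpow hu.le (by positivity), inv_rpow h0.le, inv_rpow h0.le,
      ← rpow_neg h0.le, ← rpow_neg h0.le]
    have e3 : u ^ (c - β) = u * u ^ (c - 1) * u ^ (-β) := by
      nth_rewrite 2 [← rpow_one u]
      rw [← rpow_add hu, ← rpow_add hu]; congr 1; ring
    have e4 : x ^ (β - c - 1) = x ^ (-2:ℝ) * x ^ (-(c - 1)) * x ^ (- -β) := by
      rw [← rpow_add h0, ← rpow_add h0]; congr 1; ring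
    rw [e3, e4]; ring
  constructor
  · rw [← himg, integrableOn_image_iff_integrableOn_abs_deriv_smul measurableSet_Ioo hder hinj,
      integrableOn_congr_fun hEq measurableSet_Ioo]
    exact hi.const_mul _
  · rw [← himg, integral_image_eq_integral_abs_deriv_smul measurableSet_Ioo hder hinj,
      setIntegral_congr_fun measurableSet_Ioo hEq, integral_const_mul, hv]
    congr 2
    · ring
    · congr 1; ring

lemma one_le_sqrt_pi : 1 ≤ √π := by
  rw [Real.one_le_sqrt]; linarith [pi_gt_three]

lemma Gamma_three_half : Real.Gamma (3 / 2) = √π / 2 := by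
  rw [show (3:ℝ)/2 = 1/2 + 1 by norm_num, Real.Gamma_add_one (by norm_num), Gamma_one_half_eq]
  ring

lemma gamma_bound {k n : ℕ} (hn : 1 ≤ n) (hk : k ≤ n) :
    Real.Gamma ((k:ℝ) / 2 + 1) ≤ √π * Real.Gamma ((n:ℝ) / 2 + 1) := by
  have hs := one_le_sqrt_pi
  have hpos : 0 < Real.Gamma ((n:ℝ) / 2 + 1) := Real.Gamma_pos_of_pos (by positivity)
  have hmono := Real.Gamma_strictMonoOn_Ici.monotoneOn
  by_cases h2 : 2 ≤ k
  · have h2' : (2:ℝ) ≤ k := by exact_mod_cast h2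
    have hk' : (k:ℝ) ≤ n := by exact_mod_cast hk
    have : Real.Gamma ((k:ℝ) / 2 + 1) ≤ Real.Gamma ((n:ℝ) / 2 + 1) :=
      hmono (Set.mem_Ici.2 (by linarith)) (Set.mem_Ici.2 (by linarith)) (by linarith)
    nlinarith
  · have hk1 : Real.Gamma ((k:ℝ) / 2 + 1) ≤ 1 := by
      obtain rfl | rfl : k = 0 ∨ k = 1 := by omega
      · simp
      · rw [show (((1:ℕ):ℝ) / 2 + 1) = 3 / 2 by norm_num]
        exact Real.Gamma_three_div_two_lt_one.le
    refine hk1.trans ?_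
    rcases hn.eq_or_lt with rfl | hn2
    · rw [show (((1:ℕ):ℝ) / 2 + 1) = 3 / 2 by norm_num, Gamma_three_half]
      have := Real.mul_self_sqrt pi_pos.le
      nlinarith [pi_gt_three]
    · have hn' : (2:ℝ) ≤ n := by exact_mod_cast hn2
      have : Real.Gamma 2 ≤ Real.Gamma ((n:ℝ) / 2 + 1) :=
        hmono (Set.mem_Ici.2 le_rfl) (Set.mem_Ici.2 (by linarith)) (by linarith)
      rw [Real.Gamma_two] at this
      nlinarith


/-- The upper bound for the β'-intensity integral:
`∫_u^∞ (A + √(h-u))^{d-1} h^{-β} dh ≤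
  (√π Γ((d+1)/2) max(Γ(β-(d+1)/2), Γ(β-1)) / Γ(β)) u^{1-β} (A+√u)^{d-1}`,
the analytic content of the lower-boundary concentration bound in Lemma 4.1(2b). -/
theorem intensity_integral_betaPrime_le
    (d : ℕ) (hd : 2 ≤ d) (β A u : ℝ) (hβ : ((d:ℝ) + 1) / 2 < β) (hA : 0 ≤ A) (hu : 0 < u) :
    ∫ h in Set.Ioi u, (A + Real.sqrt (h - u)) ^ (d - 1) * h ^ (-β) ≤
      (Real.sqrt Real.pi * Real.Gamma (((d:ℝ) + 1) / 2) *
          max (Real.Gamma (β - ((d:ℝ) + 1) / 2)) (Real.Gamma (β - 1)) / Real.Gamma β) *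
        u ^ (1 - β) * (A + Real.sqrt u) ^ (d - 1) := by
  obtain ⟨n, rfl⟩ : ∃ n, d = n + 1 := ⟨d - 1, by omega⟩
  have hn : 1 ≤ n := by omega
  push_cast at hβ ⊢
  rw [show ((n:ℝ) + 1 + 1) / 2 = n / 2 + 1 by ring]
  have hβ' : (n:ℝ) / 2 + 1 < β := by linarith
  have hβ0 : 0 < β := by
    have : (0:ℝ) ≤ n := by positivity
    linarith
  have hGβ : 0 < Real.Gamma β := Real.Gamma_pos_of_pos hβ0
  set M := max (Real.Gamma (β - ((n:ℝ) / 2 + 1))) (Real.Gamma (β - 1)) with hM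
  set C := √π * Real.Gamma ((n:ℝ) / 2 + 1) * M / Real.Gamma β with hC
  have hcβ : ∀ k ∈ Finset.range (n + 1), (k:ℝ) / 2 + 1 < β := by
    intro k hk
    have : (k:ℝ) ≤ n := by exact_mod_cast Nat.lt_succ_iff.1 (Finset.mem_range.1 hk)
    linarith
  have hexp : Set.EqOn (fun h : ℝ => (A + √(h - u)) ^ n * h ^ (-β))
      (fun h => ∑ k ∈ Finset.range (n + 1), (A ^ (n - k) * (n.choose k : ℝ)) *
        ((h - u) ^ (((k:ℝ) / 2 + 1) - 1) * h ^ (-β))) (Set.Ioi u) := by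
    intro h hh
    have hpos : 0 < h - u := sub_pos.2 hh
    simp only
    rw [add_comm A, add_pow, Finset.sum_mul]
    refine Finset.sum_congr rfl fun k _ => ?_
    have : (h - u) ^ (((k:ℝ) / 2 + 1) - 1) = √(h - u) ^ k := by
      rw [sqrt_eq_rpow, ← rpow_natCast, ← rpow_mul hpos.le]; congr 1; ring
    rw [this]; ring
  rw [setIntegral_congr_fun measurableSet_Ioi hexp, integral_finset_sum]
  swap
  · intro k hk
    exact (pow_int_aux (by positivity) (hcβ k hk) hu).1.const_mul _
  rw [add_comm A, add_pow, Finset.mul_sum]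
  refine Finset.sum_le_sum fun k hk => ?_
  have hkn : k ≤ n := Nat.lt_succ_iff.1 (Finset.mem_range.1 hk)
  have hkn' : (k:ℝ) ≤ n := by exact_mod_cast hkn
  have hk0 : (0:ℝ) ≤ k := by positivity
  rw [integral_const_mul, (pow_int_aux (by positivity) (hcβ k hk) hu).2]
  have hu1 : u ^ ((k:ℝ) / 2 + 1 - β) = u ^ (1 - β) * √u ^ k := by
    rw [sqrt_eq_rpow, ← rpow_natCast, ← rpow_mul hu.le, ← rpow_add hu]; congr 1; ring
  have hmax : Real.Gamma (β - ((k:ℝ) / 2 + 1)) ≤ M :=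
    Real.convexOn_Gamma.le_max_of_mem_Icc (Set.mem_Ioi.2 (by linarith))
      (Set.mem_Ioi.2 (by linarith)) ⟨by linarith, by linarith⟩
  have hle : Real.Gamma ((k:ℝ) / 2 + 1) * Real.Gamma (β - ((k:ℝ) / 2 + 1)) / Real.Gamma β ≤ C := by
    have hp : 0 < Real.Gamma (β - ((k:ℝ) / 2 + 1)) :=
      Real.Gamma_pos_of_pos (by linarith)
    have hq : 0 < Real.Gamma ((n:ℝ) / 2 + 1) := Real.Gamma_pos_of_pos (by positivity)
    rw [hC]
    gcongr
    exact gamma_bound hn hkn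
  rw [hu1]
  calc _ = (A ^ (n - k) * (n.choose k : ℝ) * (u ^ (1 - β) * √u ^ k)) *
        (Real.Gamma ((k:ℝ) / 2 + 1) * Real.Gamma (β - ((k:ℝ) / 2 + 1)) / Real.Gamma β) := by ring
    _ ≤ (A ^ (n - k) * (n.choose k : ℝ) * (u ^ (1 - β) * √u ^ k)) * C := by
        gcongr
    _ = _ := by ring
end

section
/- Let d ≥ 2 be an integer, let i be an integer with 0 ≤ i ≤ d−1, let β > −1 be real and let C > 0. Then there exists a constant C' > 0, depending only on d, i, β and C, such that for all Q > 1/4 one has ∫_Q^∞ s^{−(d−1)/2} (s+1)^{i/2} exp(−C s^{(d+1)/2 + β}) ds ≤ C' · Q^{1−d−β} · (Q+1)^{i/2} · exp(−C Q^{(d+1)/2 + β}). -/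
open MeasureTheory Real

lemma aux_anti (p q : ℝ) (hq : 0 ≤ q) (hpq : p + q ≤ 0) (Q s : ℝ) (hQ : 0 < Q) (hs : Q ≤ s) :
    s ^ p * (s + 1) ^ q ≤ Q ^ p * (Q + 1) ^ q := by
  have key : ∀ x : ℝ, 0 < x → x ^ p * (x + 1) ^ q = x ^ (p + q) * ((x + 1) / x) ^ q := by
    intro x hx
    rw [Real.div_rpow (by positivity) hx.le, Real.rpow_add hx]
    have : x ^ q ≠ 0 := (Real.rpow_pos_of_pos hx q).ne'
    field_simp
  have hs0 : 0 < s := lt_of_lt_of_le hQ hs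
  rw [key s hs0, key Q hQ]
  have h1 : s ^ (p + q) ≤ Q ^ (p + q) := Real.rpow_le_rpow_of_nonpos hQ hs hpq
  have h2 : ((s + 1) / s) ^ q ≤ ((Q + 1) / Q) ^ q := by
    apply Real.rpow_le_rpow (by positivity) _ hq
    rw [div_le_div_iff₀ hs0 hQ]
    nlinarith
  exact mul_le_mul h1 h2 (by positivity) (by positivity)

lemma aux_M (a C : ℝ) (ha : 1 / 2 < a) (hC : 0 < C) :
    ∃ M K : ℝ, 0 ≤ M ∧ 0 ≤ K ∧ (∀ s : ℝ, 1 / 4 < s → (1 - a) * s ^ (-a) ≤ C * a * M * s ^ (a - 1)) ∧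
      ∀ s : ℝ, 1 / 4 < s → M ≤ K * s ^ (1 - a) := by
  rcases le_or_gt 1 a with h | h
  · refine ⟨0, 0, le_rfl, le_rfl, ?_, ?_⟩
    · intro s hs
      have : 0 < s ^ (-a) := Real.rpow_pos_of_pos (by linarith) _
      nlinarith
    · intro s hs
      simp
  · have ha0 : 0 < a := by linarith
    have h4 : (0:ℝ) < (1 / 4) ^ (1 - 2 * a) := by positivity
    have h5 : (0:ℝ) < (1 / 4) ^ (1 - a) := by positivity
    have hM : 0 ≤ (1 - a) * (1 / 4) ^ (1 - 2 * a) / (C * a) := by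
      have : 0 < 1 - a := by linarith
      positivity
    refine ⟨(1 - a) * (1 / 4) ^ (1 - 2 * a) / (C * a),
      (1 - a) * (1 / 4) ^ (1 - 2 * a) / (C * a) / (1 / 4) ^ (1 - a), hM, by positivity, ?_, ?_⟩
    · intro s hs
      have hs0 : 0 < s := by linarith
      have e : s ^ (-a) = s ^ (1 - 2 * a) * s ^ (a - 1) := by
        rw [← Real.rpow_add hs0]; congr 1; ring
      have h6 : s ^ (1 - 2 * a) ≤ (1 / 4) ^ (1 - 2 * a) :=
        Real.rpow_le_rpow_of_nonpos (by norm_num) hs.le (by linarith)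
      rw [e, mul_div_cancel₀ _ (by positivity : C * a ≠ 0), mul_assoc]
      have : 0 < 1 - a := by linarith
      gcongr
    · intro s hs
      have h6 : (1 / 4) ^ (1 - a) ≤ s ^ (1 - a) :=
        Real.rpow_le_rpow (by norm_num) hs.le (by linarith)
      rw [div_mul_eq_mul_div, le_div_iff₀ h5]
      gcongr

lemma aux_tendsto (a C M : ℝ) (ha : 0 < a) (hC : 0 < C) :
    Filter.Tendsto (fun s : ℝ => (s ^ (1 - a) + M) * Real.exp (-C * s ^ a)) Filter.atTop
      (nhds 0) := by
  have h1 := (tendsto_rpow_mul_exp_neg_mul_atTop_nhds_zero ((1 - a) / a) C hC).comp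
    (tendsto_rpow_atTop ha)
  have h2 := (tendsto_rpow_mul_exp_neg_mul_atTop_nhds_zero 0 C hC).comp
    (tendsto_rpow_atTop ha)
  have h3 := h1.add (h2.const_mul M)
  simp only [mul_zero, add_zero] at h3
  refine h3.congr' ?_
  filter_upwards [Filter.eventually_gt_atTop 0] with s hs
  simp only [Function.comp, Real.rpow_zero, one_mul]
  rw [← Real.rpow_mul hs.le, mul_div_cancel₀ _ ha.ne']
  ring

lemma aux_deriv (a C M s : ℝ) (hs : 0 < s) :
    HasDerivAt (fun s : ℝ => (s ^ (1 - a) + M) * Real.exp (-C * s ^ a))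
      (-(C * a + C * a * M * s ^ (a - 1) - (1 - a) * s ^ (-a)) * Real.exp (-C * s ^ a)) s := by
  have h1 := (Real.hasDerivAt_rpow_const (x := s) (p := 1 - a) (Or.inl hs.ne')).add_const M
  have h2 := ((Real.hasDerivAt_rpow_const (x := s) (p := a) (Or.inl hs.ne')).const_mul (-C)).exp
  refine (h1.mul h2).congr_deriv ?_
  have e : s ^ (1 - a) * s ^ (a - 1) = 1 := by
    rw [← Real.rpow_add hs]; simp
  have e2 : (1 - a - 1) = -a := by ring
  rw [e2]
  linear_combination (-C * a * Real.exp (-C * s ^ a)) * e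

theorem tail_integral_estimate
    (d i : ℕ) (hd : 2 ≤ d) (hi : i ≤ d - 1) (β : ℝ) (hβ : -1 < β) (C : ℝ) (hC : 0 < C) :
    ∃ C' : ℝ, 0 < C' ∧ ∀ Q : ℝ, 1/4 < Q →
      ∫ s in Set.Ioi Q, s ^ (-((d:ℝ) - 1) / 2) * (s + 1) ^ ((i:ℝ) / 2) *
          Real.exp (-C * s ^ (((d:ℝ) + 1) / 2 + β)) ≤
        C' * Q ^ (1 - (d:ℝ) - β) * (Q + 1) ^ ((i:ℝ) / 2) *
          Real.exp (-C * Q ^ (((d:ℝ) + 1) / 2 + β)) := by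
  have hd' : (2:ℝ) ≤ d := by exact_mod_cast hd
  have hi' : (i:ℝ) + 1 ≤ d := by
    have : i + 1 ≤ d := by omega
    exact_mod_cast this
  have hi0 : (0:ℝ) ≤ i := Nat.cast_nonneg i
  obtain ⟨a, hadef⟩ : ∃ a, a = ((d:ℝ) + 1) / 2 + β := ⟨_, rfl⟩
  obtain ⟨p, hpdef⟩ : ∃ p, p = -((d:ℝ) - 1) / 2 := ⟨_, rfl⟩
  obtain ⟨q, hqdef⟩ : ∃ q, q = (i:ℝ) / 2 := ⟨_, rfl⟩
  have hexp : 1 - (d:ℝ) - β = p + (1 - a) := by rw [hadef, hpdef]; ring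
  rw [hexp, ← hadef, ← hpdef, ← hqdef]
  have ha : 1 / 2 < a := by linarith
  have hq : 0 ≤ q := by linarith
  have hpq : p + q ≤ 0 := by linarith
  have ha0 : 0 < a := by linarith
  obtain ⟨M, K, hM, hK, h1, h2⟩ := aux_M a C ha hC
  refine ⟨(1 + K) / (C * a), by positivity, ?_⟩
  intro Q hQ
  have hQ0 : 0 < Q := by linarith
  have hder : ∀ s ∈ Set.Ici Q, HasDerivAt _ _ s := fun s hs =>
    aux_deriv a C M s (lt_of_lt_of_le hQ0 hs)
  have hle : ∀ s ∈ Set.Ioi Q, -(C * a + C * a * M * s ^ (a - 1) - (1 - a) * s ^ (-a)) *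
      Real.exp (-C * s ^ a) ≤ -(C * a) * Real.exp (-C * s ^ a) := by
    intro s hs
    have := h1 s (lt_trans hQ hs)
    apply mul_le_mul_of_nonneg_right _ (Real.exp_pos _).le
    linarith
  have hneg : ∀ s ∈ Set.Ioi Q, -(C * a + C * a * M * s ^ (a - 1) - (1 - a) * s ^ (-a)) *
      Real.exp (-C * s ^ a) ≤ 0 := by
    intro s hs
    have : 0 < C * a * Real.exp (-C * s ^ a) := by positivity
    linarith [hle s hs]
  have hint := integrableOn_Ioi_deriv_of_nonpos' hder hneg (aux_tendsto a C M ha0 hC)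
  have hval := integral_Ioi_of_hasDerivAt_of_nonpos' hder hneg (aux_tendsto a C M ha0 hC)
  have hW : 0 < Q ^ p * (Q + 1) ^ q := by positivity
  calc ∫ s in Set.Ioi Q, s ^ p * (s + 1) ^ q * Real.exp (-C * s ^ a)
      ≤ ∫ s in Set.Ioi Q, (-(Q ^ p * (Q + 1) ^ q / (C * a))) *
        (-(C * a + C * a * M * s ^ (a - 1) - (1 - a) * s ^ (-a)) * Real.exp (-C * s ^ a)) := by
        apply integral_mono_of_nonneg
        · filter_upwards [ae_restrict_mem measurableSet_Ioi] with s hs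
          have : 0 < s := lt_trans hQ0 hs
          simp only [Pi.zero_apply]
          positivity
        · exact hint.const_mul _
        · filter_upwards [ae_restrict_mem measurableSet_Ioi] with s hs
          have hs' : Q < s := hs
          calc s ^ p * (s + 1) ^ q * Real.exp (-C * s ^ a)
              ≤ Q ^ p * (Q + 1) ^ q * Real.exp (-C * s ^ a) :=
                mul_le_mul_of_nonneg_right (aux_anti p q hq hpq Q s hQ0 hs'.le) (Real.exp_pos _).le
            _ = (-(Q ^ p * (Q + 1) ^ q / (C * a))) * (-(C * a) * Real.exp (-C * s ^ a)) := by
                field_simp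
            _ ≤ _ := mul_le_mul_of_nonpos_left (hle s hs)
                  (neg_nonpos.mpr (by positivity))
    _ = Q ^ p * (Q + 1) ^ q / (C * a) * ((Q ^ (1 - a) + M) * Real.exp (-C * Q ^ a)) := by
        rw [integral_const_mul, hval]; ring
    _ ≤ Q ^ p * (Q + 1) ^ q / (C * a) * (((1 + K) * Q ^ (1 - a)) * Real.exp (-C * Q ^ a)) := by
        have := h2 Q hQ
        have h3 : Q ^ (1 - a) + M ≤ (1 + K) * Q ^ (1 - a) := by linarith
        gcongr
    _ = _ := by
        rw [Real.rpow_add hQ0]; ring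
end
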